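/- arXiv:2204.01484 — 2 statements merged into one kernel-verified Lean document; each statement's English description precedes it below -/
import Mathlib

section
/- For real a > 1 and b, T > 0, the truncated integral (1/(2πi)) ∫_{b−iT}^{b+iT} aˢ/(s(s+1)) ds equals 1 − 1/a + R₁, where |R₁| ≪ a^b · min(1/T, 1/(T² log a)). -/
open Complex MeasureTheory Set Filter Topology

noncomputable def auxF (a b t : ℝ) : ℂ :=
  (a : ℂ) ^ ((b : ℂ) + t * I) / (((b : ℂ) + t * I) * ((b : ℂ) + t * I + 1))

lemma aux_ne0 {b : ℝ} (hb : 0 < b) (t : ℝ) : (b : ℂ) + t * I ≠ 0 := by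
  intro h
  have := congrArg Complex.re h
  simp at this
  linarith

lemma aux_ne1 {b : ℝ} (hb : 0 < b) (t : ℝ) : (b : ℂ) + t * I + 1 ≠ 0 := by
  intro h
  have := congrArg Complex.re h
  simp at this
  linarith

lemma aux_norm0 (b t : ℝ) : |t| ≤ ‖(b : ℂ) + t * I‖ := by
  simpa using Complex.abs_im_le_norm ((b : ℂ) + t * I)

lemma aux_norm1 (b t : ℝ) : |t| ≤ ‖(b : ℂ) + t * I + 1‖ := by
  simpa using Complex.abs_im_le_norm ((b : ℂ) + t * I + 1)

lemma aux_cpow_norm {a : ℝ} (ha : 1 < a) (b t : ℝ) : ‖(a : ℂ) ^ ((b : ℂ) + t * I)‖ = a ^ b := by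
  rw [Complex.norm_cpow_eq_rpow_re_of_pos (by linarith)]
  simp

lemma aux_cont_cpow {a : ℝ} (ha : 1 < a) (b : ℝ) :
    Continuous (fun t : ℝ => (a : ℂ) ^ ((b : ℂ) + t * I)) := by
  have h : (a : ℂ) ≠ 0 := by exact_mod_cast (by linarith : a ≠ 0)
  exact Continuous.const_cpow (by fun_prop) (Or.inl h)

lemma auxF_cont {a b : ℝ} (ha : 1 < a) (hb : 0 < b) : Continuous (auxF a b) := by
  unfold auxF
  exact (aux_cont_cpow ha b).div (by fun_prop)
    (fun t => mul_ne_zero (aux_ne0 hb t) (aux_ne1 hb t))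

lemma aux_prod_bound {b : ℝ} (hb : 0 < b) (t : ℝ) :
    ‖1 / (((b : ℂ) + t * I) * ((b : ℂ) + t * I + 1))‖ ≤ (min b 1)⁻¹ * (1 + t ^ 2)⁻¹ := by
  have hm : 0 < min b 1 := lt_min hb one_pos
  have hm1 : min b 1 ≤ 1 := min_le_right _ _
  have hmb : min b 1 ≤ b := min_le_left _ _
  set m := min b 1
  have e0 : ‖(b : ℂ) + t * I‖ ^ 2 = b ^ 2 + t ^ 2 := by
    rw [Complex.sq_norm, Complex.normSq_apply]; simp; ring
  have e1 : ‖(b : ℂ) + t * I + 1‖ ^ 2 = (b + 1) ^ 2 + t ^ 2 := by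
    rw [Complex.sq_norm, Complex.normSq_apply]; simp; ring
  rw [norm_div, norm_one, norm_mul, one_div, ← mul_inv]
  apply inv_anti₀ (by positivity)
  apply le_of_sq_le_sq _ (by positivity)
  rw [mul_pow, mul_pow, e0, e1]
  have h1 : m ^ 2 * (1 + t ^ 2) ≤ b ^ 2 + t ^ 2 := by
    have : m ^ 2 ≤ b ^ 2 := by gcongr
    have : m ^ 2 ≤ 1 := by nlinarith
    nlinarith [sq_nonneg t]
  have h2 : 1 + t ^ 2 ≤ (b + 1) ^ 2 + t ^ 2 := by nlinarith
  calc m ^ 2 * (1 + t ^ 2) ^ 2 = (m ^ 2 * (1 + t ^ 2)) * (1 + t ^ 2) := by ring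
    _ ≤ _ := by gcongr

lemma aux_int0 {b : ℝ} (hb : 0 < b) :
    Integrable (fun t : ℝ => 1 / (((b : ℂ) + t * I) * ((b : ℂ) + t * I + 1))) := by
  refine (integrable_inv_one_add_sq.const_mul (min b 1)⁻¹).mono'
    (Continuous.aestronglyMeasurable ?_) (Eventually.of_forall (aux_prod_bound hb))
  exact continuous_const.div (by fun_prop)
    (fun t => mul_ne_zero (aux_ne0 hb t) (aux_ne1 hb t))

lemma auxF_int {a b : ℝ} (ha : 1 < a) (hb : 0 < b) : Integrable (auxF a b) := by
  refine ((integrable_inv_one_add_sq.const_mul (min b 1)⁻¹).const_mul (a ^ b)).mono'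
    (auxF_cont ha hb).aestronglyMeasurable (Eventually.of_forall fun t => ?_)
  rw [auxF, div_eq_mul_one_div, norm_mul, aux_cpow_norm ha]
  have : 0 ≤ a ^ b := by positivity
  exact mul_le_mul_of_nonneg_left (aux_prod_bound hb t) this

lemma aux_full {a b : ℝ} (ha : 1 < a) (hb : 0 < b) :
    (1 / (2 * Real.pi) : ℂ) * ∫ t, auxF a b t = 1 - 1 / (a : ℂ) := by
  have ha0 : 0 < a := by linarith
  set f : ℝ → ℂ := fun t => indicator (Ioc 0 1) (fun _ => 1 : ℝ → ℂ) t
    - indicator (Ioc 0 1) (fun t => (t : ℂ) ^ (1 : ℂ) : ℝ → ℂ) t with hf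
  have hM : ∀ s : ℂ, 0 < s.re → HasMellin f s (1 / (s * (s + 1))) := by
    intro s hs
    have h1 := hasMellin_one_Ioc hs
    have h2 := hasMellin_cpow_Ioc (1 : ℂ) (s := s) (by simp; linarith)
    have h3 := hasMellin_sub h1.1 h2.1
    rw [h1.2, h2.2] at h3
    have : s ≠ 0 := by rintro rfl; simp at hs
    have : s + 1 ≠ 0 := by
      intro h
      have := congrArg Complex.re h
      simp at this
      linarith
    have e : 1 / (s * (s + 1)) = 1 / s - 1 / (s + 1) := by
      field_simp
      ring
    rw [e]
    exact h3
  have hval : ∀ t : ℝ, mellin f ((b : ℂ) + t * I)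
      = 1 / (((b : ℂ) + t * I) * ((b : ℂ) + t * I + 1)) :=
    fun t => (hM _ (by simpa using hb)).2
  have hx : (0 : ℝ) < a⁻¹ := by positivity
  have hx1 : a⁻¹ < 1 := inv_lt_one_of_one_lt₀ ha
  have key := mellinInv_mellin_eq b f hx (hM b (by simpa using hb)).1
    (by
      unfold VerticalIntegrable
      simp_rw [hval]
      exact aux_int0 hb)
    (by
      have : f =ᶠ[𝓝 a⁻¹] fun t : ℝ => (1 : ℂ) - t := by
        filter_upwards [Ioo_mem_nhds hx hx1] with t ht
        have ht' : t ∈ Ioc (0 : ℝ) 1 := ⟨ht.1, ht.2.le⟩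
        simp [hf, ht'.1, ht'.2]
      rw [continuousAt_congr this]
      fun_prop)
  have hfx : f a⁻¹ = 1 - 1 / (a : ℂ) := by
    have ht' : a⁻¹ ∈ Ioc (0 : ℝ) 1 := ⟨hx, hx1.le⟩
    simp only [hf, indicator_of_mem ht']
    simp
  rw [hfx] at key
  rw [← key, mellinInv, Complex.real_smul]
  push_cast
  congr 1
  apply integral_congr_ae
  refine Eventually.of_forall fun t => ?_
  simp only [hval, auxF, smul_eq_mul]
  have : ((a : ℂ))⁻¹ ^ (-((b : ℂ) + t * I)) = (a : ℂ) ^ ((b : ℂ) + t * I) := by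
    rw [Complex.inv_cpow _ _ (by
      rw [Complex.arg_ofReal_of_nonneg ha0.le]; exact Real.pi_pos.ne), Complex.cpow_neg, inv_inv]
  rw [this]
  ring

lemma aux_tail1 {a b T e : ℝ} (ha : 1 < a) (hT : 0 < T) (he : |e| = 1) :
    ‖∫ t in Ioi T, auxF a b (e * t)‖ ≤ a ^ b * (1 / T) := by
  have h2 : ∫ t in Ioi T, a ^ b * t ^ (-2 : ℝ) = a ^ b * (1 / T) := by
    rw [integral_const_mul, integral_Ioi_rpow_of_lt (by norm_num) hT]
    norm_num [Real.rpow_neg_one]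
  rw [← h2]
  apply norm_integral_le_of_norm_le
  · exact (integrableOn_Ioi_rpow_of_lt (by norm_num) hT).const_mul _
  · refine (ae_restrict_iff' measurableSet_Ioi).2 (Eventually.of_forall fun t ht => ?_)
    have ht0 : 0 < t := hT.trans ht
    have hab : |e * t| = t := by rw [abs_mul, he, one_mul, abs_of_pos ht0]
    have n0 := aux_norm0 b (e * t)
    have n1 := aux_norm1 b (e * t)
    rw [hab] at n0 n1
    rw [auxF, norm_div, aux_cpow_norm ha, norm_mul, div_eq_mul_inv, Real.rpow_neg ht0.le]
    norm_num
    rw [← mul_inv, sq]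
    have : 0 ≤ a ^ b := by positivity
    push_cast at n0 n1
    gcongr

lemma aux_tail2 {a b T e : ℝ} (ha : 1 < a) (hb : 0 < b) (hT : 0 < T) (he : |e| = 1) :
    ‖∫ t in Ioi T, auxF a b (e * t)‖ ≤ 2 * a ^ b * (1 / (T ^ 2 * Real.log a)) := by
  have hL : 0 < Real.log a := Real.log_pos ha
  have ha0 : (a : ℂ) ≠ 0 := by exact_mod_cast (by linarith : a ≠ 0)
  have hab0 : 0 ≤ a ^ b := by positivity
  have he0 : e ≠ 0 := by rintro rfl; simp at he
  have heC : (e : ℂ) ≠ 0 := by exact_mod_cast he0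
  set L := Real.log a with hLdef
  have hLC : (L : ℂ) ≠ 0 := by exact_mod_cast hL.ne'
  have hlog : Complex.log a = L := (Complex.ofReal_log (by linarith)).symm
  let s : ℝ → ℂ := fun t => (b : ℂ) + ((e * t : ℝ) : ℂ) * I
  let P : ℝ → ℂ := fun t => (a : ℂ) ^ s t
  let G : ℝ → ℂ := fun t => P t / L * (1 / (s t ^ 2 * (s t + 1)) + 1 / (s t * (s t + 1) ^ 2))
  let H : ℝ → ℂ := fun t => auxF a b (e * t) / (L * e * I)
  have hs0 : ∀ t, s t ≠ 0 := fun t => aux_ne0 hb _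
  have hs1 : ∀ t, s t + 1 ≠ 0 := fun t => aux_ne1 hb _
  have hPc : Continuous P := (aux_cont_cpow ha b).comp (continuous_const.mul continuous_id)
  have hsc : Continuous s := by fun_prop
  have hGc : Continuous G := by
    refine (hPc.div_const _).mul ((continuous_const.div (by fun_prop) fun t => ?_).add
      (continuous_const.div (by fun_prop) fun t => ?_))
    · exact mul_ne_zero (pow_ne_zero _ (hs0 t)) (hs1 t)
    · exact mul_ne_zero (hs0 t) (pow_ne_zero _ (hs1 t))
  have hds : ∀ t, HasDerivAt s (e * I) t := by
    intro t
    have h1 : HasDerivAt (fun t : ℝ => ((e * t : ℝ) : ℂ)) (e : ℂ) t := by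
      have := ((hasDerivAt_id t).const_mul e).ofReal_comp
      simpa using this
    exact (h1.mul_const I).const_add _
  have hdP : ∀ t, HasDerivAt P (P t * L * (e * I)) t := by
    intro t
    have h := (Complex.hasStrictDerivAt_const_cpow (x := (a : ℂ)) (y := s t)
      (Or.inl ha0)).hasDerivAt.comp t (hds t)
    rw [hlog] at h
    exact h
  have hdH : ∀ t, HasDerivAt H (auxF a b (e * t) - G t) t := by
    intro t
    have h := ((hdP t).div ((hds t).mul ((hds t).add_const 1))
      (mul_ne_zero (hs0 t) (hs1 t))).div_const (L * e * I)
    refine h.congr_deriv (Eq.symm ?_)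
    have h0 := hs0 t
    have h1 := hs1 t
    change P t / (s t * (s t + 1)) - P t / L * (1 / (s t ^ 2 * (s t + 1)) + 1 / (s t * (s t + 1) ^ 2)) = _
    simp only [Pi.mul_apply]
    have hI : I ≠ 0 := I_ne_zero
    generalize s t = z at *
    generalize P t = p at *
    field_simp
  have hbound : ∀ t, T ≤ t → t ≤ ‖s t‖ ∧ t ≤ ‖s t + 1‖ := by
    intro t ht
    have hab : |e * t| = t := by rw [abs_mul, he, one_mul, abs_of_pos (hT.trans_le ht)]
    have n0 := aux_norm0 b (e * t)
    have n1 := aux_norm1 b (e * t)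
    rw [hab] at n0 n1
    exact ⟨n0, n1⟩
  have hPn : ∀ t, ‖P t‖ = a ^ b := fun t => aux_cpow_norm ha b (e * t)
  have hLn : ‖(L : ℂ)‖ = L := by simp [abs_of_pos hL]
  have hFn : ∀ t, T ≤ t → ‖auxF a b (e * t)‖ ≤ a ^ b * (t ^ 2)⁻¹ := by
    intro t ht
    obtain ⟨n0, n1⟩ := hbound t ht
    have ht0 := hT.trans_le ht
    change ‖P t / (s t * (s t + 1))‖ ≤ _
    rw [norm_div, hPn, norm_mul, div_eq_mul_inv, sq]
    gcongr
  have hHn : ∀ t, ‖H t‖ = ‖auxF a b (e * t)‖ / L := by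
    intro t
    simp only [H]
    rw [norm_div, norm_mul, norm_mul, hLn]
    simp [he]
  have hGn : ∀ t ∈ Ioi T, ‖G t‖ ≤ 2 * a ^ b / L * t ^ (-3 : ℝ) := by
    intro t ht
    obtain ⟨n0, n1⟩ := hbound t (le_of_lt ht)
    have ht0 : 0 < t := hT.trans ht
    have hr : t ^ (-3 : ℝ) = (t ^ 3)⁻¹ := by
      rw [Real.rpow_neg ht0.le]; norm_num
    simp only [G]
    rw [norm_mul, norm_div, hPn, hLn, hr]
    have k1 : ‖1 / (s t ^ 2 * (s t + 1))‖ ≤ (t ^ 3)⁻¹ := by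
      rw [norm_div, norm_one, norm_mul, norm_pow, one_div, show t ^ 3 = t ^ 2 * t by ring]
      gcongr
    have k2 : ‖1 / (s t * (s t + 1) ^ 2)‖ ≤ (t ^ 3)⁻¹ := by
      rw [norm_div, norm_one, norm_mul, norm_pow, one_div, show t ^ 3 = t * t ^ 2 by ring]
      gcongr
    calc a ^ b / L * _ ≤ a ^ b / L * ((t ^ 3)⁻¹ + (t ^ 3)⁻¹) := by
          gcongr
          exact (norm_add_le _ _).trans (add_le_add k1 k2)
      _ = _ := by ring
  have hmaj : IntegrableOn (fun t : ℝ => 2 * a ^ b / L * t ^ (-3 : ℝ)) (Ioi T) :=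
    (integrableOn_Ioi_rpow_of_lt (by norm_num) hT).const_mul _
  have hGae : ∀ᵐ t ∂(volume.restrict (Ioi T)), ‖G t‖ ≤ 2 * a ^ b / L * t ^ (-3 : ℝ) :=
    (ae_restrict_iff' measurableSet_Ioi).2 (Eventually.of_forall hGn)
  have hGi : IntegrableOn G (Ioi T) := Integrable.mono' hmaj hGc.aestronglyMeasurable hGae
  have hFi : IntegrableOn (fun t => auxF a b (e * t)) (Ioi T) :=
    ((auxF_int ha hb).comp_mul_left' he0).integrableOn
  have hlim : Tendsto H atTop (𝓝 0) := by
    have hz : Tendsto (fun t : ℝ => a ^ b * (t ^ 2)⁻¹ / L) atTop (𝓝 0) := by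
      have := ((tendsto_inv_atTop_zero.comp
        (tendsto_pow_atTop (α := ℝ) (n := 2) (by norm_num))).const_mul (a ^ b)).div_const L
      simpa using this
    refine squeeze_zero_norm' ?_ hz
    filter_upwards [eventually_ge_atTop T] with t ht
    rw [hHn]
    gcongr
    exact hFn t ht
  have hI := integral_Ioi_of_hasDerivAt_of_tendsto' (a := T) (fun t _ => hdH t) (hFi.sub hGi) hlim
  rw [integral_sub hFi hGi] at hI
  have hGint : ‖∫ t in Ioi T, G t‖ ≤ a ^ b / L * (T ^ 2)⁻¹ := by
    refine (norm_integral_le_of_norm_le hmaj hGae).trans (le_of_eq ?_)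
    rw [integral_const_mul, integral_Ioi_rpow_of_lt (by norm_num) hT]
    have : T ^ (-3 + 1 : ℝ) = (T ^ 2)⁻¹ := by
      rw [show (-3 + 1 : ℝ) = -2 by norm_num, Real.rpow_neg hT.le]; norm_num
    rw [this]
    ring
  have hHT : ‖H T‖ ≤ a ^ b / L * (T ^ 2)⁻¹ := by
    rw [hHn]
    calc _ ≤ a ^ b * (T ^ 2)⁻¹ / L := by
          gcongr
          exact hFn T le_rfl
      _ = _ := by ring
  have : ∫ t in Ioi T, auxF a b (e * t) = (∫ t in Ioi T, G t) - H T := by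
    linear_combination hI
  rw [this]
  calc _ ≤ _ := norm_sub_le _ _
    _ ≤ a ^ b / L * (T ^ 2)⁻¹ + a ^ b / L * (T ^ 2)⁻¹ := add_le_add hGint hHT
    _ = _ := by rw [one_div, mul_inv]; ring

theorem stmt_2 :
    ∃ C > 0, ∀ a b T : ℝ, 1 < a → 0 < b → 0 < T →
      ∃ R₁ : ℂ,
        (1 / (2 * Real.pi * Complex.I)) *
            ∫ t in (-T)..T,
              (a : ℂ) ^ ((b : ℂ) + t * Complex.I) /
                  (((b : ℂ) + t * Complex.I) * ((b : ℂ) + t * Complex.I + 1)) * Complex.I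
          = 1 - 1 / (a : ℂ) + R₁ ∧
        ‖R₁‖ ≤ C * a ^ b * min (1 / T) (1 / (T ^ 2 * Real.log a)) := by
  refine ⟨1, one_pos, fun a b T ha hb hT => ?_⟩
  have hL : 0 < Real.log a := Real.log_pos ha
  have hint := auxF_int ha hb
  have hsplit : ∫ t in (-T)..T, auxF a b t = (∫ t, auxF a b t)
      - ((∫ t in Ioi T, auxF a b (1 * t)) + ∫ t in Ioi T, auxF a b (-1 * t)) := by
    have h1 := intervalIntegral.integral_interval_add_Ioi (a := -T) (b := T)
      hint.integrableOn hint.integrableOn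
    have h2 := intervalIntegral.integral_Iic_add_Ioi (b := -T)
      hint.integrableOn hint.integrableOn
    have h3 := integral_comp_neg_Ioi T (auxF a b)
    simp only [one_mul, neg_mul]
    rw [h3, ← h2, ← h1]
    ring
  refine ⟨-((1 / (2 * Real.pi) : ℂ) *
    ((∫ t in Ioi T, auxF a b (1 * t)) + ∫ t in Ioi T, auxF a b (-1 * t))), ?_, ?_⟩
  · rw [← aux_full ha hb, intervalIntegral.integral_mul_const]
    change _ * ((∫ t in (-T)..T, auxF a b t) * I) = _
    rw [hsplit]
    have hI : I ≠ 0 := I_ne_zero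
    have hpi : (Real.pi : ℂ) ≠ 0 := by exact_mod_cast Real.pi_ne_zero
    field_simp
    ring
  · have hab0 : 0 ≤ a ^ b := by positivity
    have hn : ‖(1 / (2 * Real.pi) : ℂ)‖ = 1 / (2 * Real.pi) := by
      simp [abs_of_pos Real.pi_pos]
    have hc : 1 / (2 * Real.pi) ≤ 1 / 4 := by
      have := Real.pi_gt_three
      apply one_div_le_one_div_of_le <;> linarith
    rw [norm_neg, norm_mul, hn, one_mul]
    have key : ∀ M : ℝ, ‖∫ t in Ioi T, auxF a b (1 * t)‖ ≤ 2 * M →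
        ‖∫ t in Ioi T, auxF a b (-1 * t)‖ ≤ 2 * M →
        1 / (2 * Real.pi) * ‖(∫ t in Ioi T, auxF a b (1 * t)) + ∫ t in Ioi T, auxF a b (-1 * t)‖
          ≤ M := by
      intro M h1 h2
      have h3 := norm_add_le (∫ t in Ioi T, auxF a b (1 * t)) (∫ t in Ioi T, auxF a b (-1 * t))
      calc _ ≤ 1 / 4 * (2 * M + 2 * M) := by
            gcongr
            linarith
        _ = M := by ring
    have e1 : |(1 : ℝ)| = 1 := by simp
    have e2 : |(-1 : ℝ)| = 1 := by simp
    rw [mul_min_of_nonneg _ _ hab0]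
    refine le_min (key _ ?_ ?_) (key _ ?_ ?_)
    · have := aux_tail1 (b := b) ha hT e1
      have : 0 ≤ a ^ b * (1 / T) := by positivity
      linarith
    · have := aux_tail1 (b := b) ha hT e2
      have : 0 ≤ a ^ b * (1 / T) := by positivity
      linarith
    · have := aux_tail2 ha hb hT e1
      linarith
    · have := aux_tail2 ha hb hT e2
      linarith
end

section
/- Assuming the zero-free region: every non-trivial zero ρ = β + iγ of ζ with |γ| ≤ T satisfies β ≤ η, one has |∑_{|Im ρ| ≤ T} x^ρ/(ρ(ρ+1))| ≤ C · x^η for an absolute constant C, for all x ≥ 2 and T ≥ 2, where the sum is over non-trivial zeros with |Im ρ| ≤ T counted with multiplicity. -/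
def NontrivialZero (ρ : ℂ) : Prop :=
  riemannZeta ρ = 0 ∧ 0 < ρ.re ∧ ρ.re < 1

open MeasureTheory Set in
lemma aux_norm_Gamma_le {s : ℂ} (hs : 0 < s.re) : ‖Complex.Gamma s‖ ≤ Real.Gamma s.re := by
  rw [Complex.Gamma_eq_integral hs, Complex.GammaIntegral, Real.Gamma_eq_integral hs]
  refine (norm_integral_le_integral_norm _).trans (le_of_eq ?_)
  refine setIntegral_congr_fun measurableSet_Ioi fun x (hx : 0 < x) => ?_
  simp only [norm_mul]
  rw [Complex.norm_cpow_eq_rpow_re_of_pos hx, Complex.norm_real,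
    Real.norm_of_nonneg (Real.exp_pos _).le]
  simp

lemma aux_zeta_bound : ∃ B : ℝ, 0 < B ∧ ∀ s : ℂ, 4 ≤ s.re → ‖riemannZeta s‖ ≤ B := by
  have hsum : Summable (fun n : ℕ => 1 / ((n : ℝ) + 1) ^ 2) := by
    have := (summable_nat_add_iff 1).2 (Real.summable_one_div_nat_pow.2 (one_lt_two))
    simpa using this
  refine ⟨∑' n : ℕ, 1 / ((n : ℝ) + 1) ^ 2, ?_, fun s hs => ?_⟩
  · exact hsum.tsum_pos (fun n => by positivity) 0 (by norm_num)
  · rw [zeta_eq_tsum_one_div_nat_add_one_cpow (by linarith)]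
    refine tsum_of_norm_bounded hsum.hasSum fun n => ?_
    have h0 : (0 : ℝ) < (n : ℝ) + 1 := by positivity
    have := Complex.norm_cpow_eq_rpow_re_of_pos h0 s
    push_cast at this
    rw [norm_div, this, norm_one]
    gcongr
    rw [← Real.rpow_natCast]
    apply Real.rpow_le_rpow_of_exponent_le
    · linarith [(Nat.cast_nonneg n : (0 : ℝ) ≤ n)]
    · push_cast; linarith

open MeasureTheory Set in
lemma aux_strip_bound : ∃ M : ℝ, 0 < M ∧ ∀ s : ℂ, 0 ≤ s.re → s.re ≤ 4 →
    ‖completedRiemannZeta₀ s‖ ≤ M := by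
  set P := HurwitzZeta.hurwitzEvenFEPair 0 with hP
  have hconv : ∀ s : ℂ, MellinConvergent P.f_modif s := fun s =>
    (P.isStrongFEPair_toStrongFEPair.hasMellin s).1
  have h0 := (hconv 0).norm
  have h2 := (hconv 2).norm
  have hs := h0.add h2
  refine ⟨(∫ t in Ioi (0:ℝ), (‖(t : ℂ) ^ ((0 : ℂ) - 1) • P.f_modif t‖ +
    ‖(t : ℂ) ^ ((2 : ℂ) - 1) • P.f_modif t‖)) + 1, ?_, fun s hs0 hs4 => ?_⟩
  · have : 0 ≤ ∫ t in Ioi (0:ℝ), (‖(t : ℂ) ^ ((0 : ℂ) - 1) • P.f_modif t‖ +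
      ‖(t : ℂ) ^ ((2 : ℂ) - 1) • P.f_modif t‖) := integral_nonneg fun t => by positivity
    linarith
  · have e : completedRiemannZeta₀ s = mellin P.f_modif (s / 2) / 2 := rfl
    have h1 : ‖mellin P.f_modif (s / 2)‖ ≤ ∫ t in Ioi (0:ℝ),
        (‖(t : ℂ) ^ ((0 : ℂ) - 1) • P.f_modif t‖ + ‖(t : ℂ) ^ ((2 : ℂ) - 1) • P.f_modif t‖) := by
      unfold mellin
      refine norm_integral_le_of_norm_le hs ?_
      filter_upwards [ae_restrict_mem measurableSet_Ioi] with t ht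
      have ht : 0 < t := ht
      simp only [norm_smul, Complex.norm_cpow_eq_rpow_re_of_pos ht, ← add_mul]
      gcongr
      have a1 : (s / 2 - 1).re = s.re / 2 - 1 := by
        simp
      rw [a1]
      have p1 : 0 ≤ t ^ ((0 : ℂ) - 1).re := Real.rpow_nonneg ht.le _
      have p2 : 0 ≤ t ^ ((2 : ℂ) - 1).re := Real.rpow_nonneg ht.le _
      rcases le_total t 1 with h | h
      · have : t ^ (s.re / 2 - 1) ≤ t ^ ((0 : ℂ) - 1).re := by
          apply Real.rpow_le_rpow_of_exponent_ge ht h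
          simp; linarith
        exact this.trans (le_add_of_nonneg_right p2)
      · have : t ^ (s.re / 2 - 1) ≤ t ^ ((2 : ℂ) - 1).re := by
          apply Real.rpow_le_rpow_of_exponent_le h
          norm_num; linarith
        exact this.trans (le_add_of_nonneg_left p1)
    rw [e, norm_div]
    have : ‖(2 : ℂ)‖ = 2 := by simp
    rw [this]
    have := norm_nonneg (mellin P.f_modif (s / 2))
    linarith

lemma aux_half_bound : ∃ K : ℝ, 0 < K ∧ ∀ (n : ℕ) (s : ℂ), ‖s‖ ≤ n → 0 ≤ s.re →
    ‖completedRiemannZeta₀ s‖ ≤ K * (n.factorial : ℝ) := by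
  obtain ⟨B, hB, hζ⟩ := aux_zeta_bound
  obtain ⟨M, hM, hM'⟩ := aux_strip_bound
  refine ⟨B + M + 2, by positivity, fun n s hn hs => ?_⟩
  have hf : (1 : ℝ) ≤ n.factorial := by exact_mod_cast n.factorial_pos
  rcases le_total s.re 4 with h4 | h4
  · refine (hM' s hs h4).trans ?_
    nlinarith
  · have hs0 : s ≠ 0 := by rintro rfl; simp at h4; linarith
    have hG := Complex.Gammaℝ_ne_zero_of_re_pos (s := s) (by linarith)
    have e1 : completedRiemannZeta s = Complex.Gammaℝ s * riemannZeta s := by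
      rw [riemannZeta_def_of_ne_zero hs0]; field_simp
    have e2 : completedRiemannZeta₀ s = Complex.Gammaℝ s * riemannZeta s + 1 / s + 1 / (1 - s) := by
      rw [← e1, completedRiemannZeta_eq]; ring
    have hre : s.re ≤ n := (Complex.re_le_norm s).trans hn
    have g1 : ‖Complex.Gammaℝ s‖ ≤ n.factorial := by
      rw [Complex.Gammaℝ_def, norm_mul, Complex.norm_cpow_eq_rpow_re_of_pos Real.pi_pos]
      have b1 : Real.pi ^ (-s / 2).re ≤ 1 := by
        apply Real.rpow_le_one_of_one_le_of_nonpos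
        · linarith [Real.pi_gt_three]
        · simp; linarith
      have hh : (s / 2).re = s.re / 2 := by simp
      have b2 : ‖Complex.Gamma (s / 2)‖ ≤ n.factorial := by
        refine (aux_norm_Gamma_le (by rw [hh]; linarith)).trans ?_
        rw [← Real.Gamma_nat_eq_factorial, hh]
        apply Real.Gamma_strictMonoOn_Ici.monotoneOn
        · simp; linarith
        · simp; linarith
        · linarith
      calc _ ≤ 1 * (n.factorial : ℝ) := by gcongr
        _ = _ := one_mul _
    have n1 : ‖(1 : ℂ) / s‖ ≤ 1 := by
      rw [norm_div, norm_one]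
      apply div_le_one_of_le₀ _ (norm_nonneg _)
      linarith [Complex.re_le_norm s]
    have n2 : ‖(1 : ℂ) / (1 - s)‖ ≤ 1 := by
      rw [norm_div, norm_one]
      apply div_le_one_of_le₀ _ (norm_nonneg _)
      have := Complex.abs_re_le_norm (1 - s)
      have h' := neg_abs_le (1 - s).re
      simp at this h'
      linarith
    rw [e2]
    refine (norm_add₃_le).trans ?_
    rw [norm_mul]
    have : ‖Complex.Gammaℝ s‖ * ‖riemannZeta s‖ ≤ n.factorial * B := by
      gcongr
      exact hζ s h4
    nlinarith

/-- The entire function `s (s - 1) Λ(s)`. -/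
noncomputable def auxXi (s : ℂ) : ℂ := s * (s - 1) * completedRiemannZeta₀ s + 1

lemma auxXi_differentiable : Differentiable ℂ auxXi := by
  have := differentiable_completedZeta₀
  unfold auxXi
  fun_prop

lemma auxXi_zero : auxXi 0 = 1 := by simp [auxXi]

lemma auxXi_eq_zero {s : ℂ} (h : NontrivialZero s) : auxXi s = 0 := by
  obtain ⟨h1, h2, h3⟩ := h
  have hs0 : s ≠ 0 := by rintro rfl; simp at h2
  have hs1 : 1 - s ≠ 0 := by
    intro h
    have := congrArg Complex.re h
    simp at this; linarith
  have hG := Complex.Gammaℝ_ne_zero_of_re_pos h2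
  rw [riemannZeta_def_of_ne_zero hs0, div_eq_zero_iff, or_iff_left hG,
    completedRiemannZeta_eq] at h1
  have : completedRiemannZeta₀ s = 1 / s + 1 / (1 - s) := by linear_combination h1
  rw [auxXi, this]
  field_simp
  ring

lemma auxXi_bound : ∃ K : ℝ, 1 ≤ K ∧ ∀ (n : ℕ) (s : ℂ), ‖s‖ ≤ n →
    ‖auxXi s‖ ≤ K * ((n + 3).factorial : ℝ) := by
  obtain ⟨K, hK, h⟩ := aux_half_bound
  refine ⟨K + 1, by linarith, fun n s hn => ?_⟩
  have h1 : ‖completedRiemannZeta₀ s‖ ≤ K * ((n + 1).factorial : ℝ) := by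
    rcases le_total 0 s.re with h0 | h0
    · refine (h n s hn h0).trans ?_
      gcongr
      omega
    · rw [← completedRiemannZeta₀_one_sub]
      refine h (n + 1) _ ?_ (by simp; linarith)
      refine (norm_sub_le _ _).trans ?_
      push_cast; simp; linarith
  have h2 : ‖s - 1‖ ≤ n + 1 := (norm_sub_le _ _).trans (by simp; linarith)
  have e : ((n + 3).factorial : ℝ) = (n + 3) * ((n + 2) * (n + 1).factorial) := by
    rw [Nat.factorial_succ (n + 2), Nat.factorial_succ (n + 1)]; push_cast; ring
  have hf : (1 : ℝ) ≤ (n + 3).factorial := by exact_mod_cast (n + 3).factorial_pos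
  have hn0 : (0 : ℝ) ≤ n := Nat.cast_nonneg n
  calc ‖auxXi s‖ ≤ ‖s‖ * ‖s - 1‖ * ‖completedRiemannZeta₀ s‖ + 1 := by
        refine (norm_add_le _ _).trans ?_
        simp
    _ ≤ (n + 3) * (n + 2) * (K * ((n + 1).factorial : ℝ)) + (n + 3).factorial := by
        gcongr <;> linarith
    _ = _ := by rw [e]; ring

open MeromorphicOn Metric in
lemma aux_card_le : ∃ K : ℝ, 1 ≤ K ∧ ∀ (n : ℕ) (u : Finset ℂ), 1 ≤ n →
    (∀ z ∈ u, NontrivialZero z ∧ ‖z‖ ≤ n) →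
    (u.card : ℝ) ≤ Real.log (K * ((2 * n + 3).factorial : ℝ)) / Real.log 2 := by
  obtain ⟨K, hK, hb⟩ := auxXi_bound
  refine ⟨K, hK, fun n u hn hu => ?_⟩
  have hn' : (0 : ℝ) < n := by exact_mod_cast hn
  have han : ∀ z, AnalyticAt ℂ auxXi z := fun z => auxXi_differentiable.analyticAt z
  have hf : (1 : ℝ) ≤ (2 * n + 3).factorial := by exact_mod_cast (2 * n + 3).factorial_pos
  have key := AnalyticOnNhd.sum_divisor_le (c := 0) (r := n) (R := 2 * n)
    (M := K * ((2 * n + 3).factorial : ℝ)) (f := auxXi) (by rwa [abs_of_pos hn'])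
    (by rw [abs_of_pos hn', abs_of_pos (by positivity)]; linarith)
    (by nlinarith) (fun z _ => han z) (by simp [auxXi_zero])
    (by
      intro z hz
      apply hb (2 * n) z
      rw [abs_of_pos (by positivity)] at hz
      simp at hz
      push_cast
      exact hz.le)
  have e : (2 * (n : ℝ)) / n = 2 := by field_simp
  rw [auxXi_zero, norm_one, div_one, e] at key
  refine le_trans ?_ key
  set D := divisor auxXi (closedBall (0 : ℂ) |(n : ℝ)|) with hD
  have hanU : AnalyticOnNhd ℂ auxXi (closedBall (0 : ℂ) |(n : ℝ)|) := fun z _ => han z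
  have hfin : D.support.Finite := D.finiteSupport (isCompact_closedBall _ _)
  have hne : auxXi ≠ 0 := fun h => by
    have := auxXi_zero
    rw [h] at this
    simp at this
  have hone : ∀ z ∈ u, 1 ≤ D z := by
    intro z hz
    obtain ⟨h1, h2⟩ := hu z hz
    have hmem : z ∈ closedBall (0 : ℂ) |(n : ℝ)| := by
      rw [abs_of_pos hn']; simpa using h2
    rw [hD, AnalyticOnNhd.divisor_apply hanU hmem]
    have ht : analyticOrderAt auxXi z ≠ ⊤ := by
      rw [Ne, AnalyticOnNhd.analyticOrderAt_eq_top_iff_eq_zero z han]; exact hne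
    have h0 : analyticOrderAt auxXi z ≠ 0 := by
      rw [Ne, (han z).analyticOrderAt_eq_zero]
      simpa using auxXi_eq_zero h1
    lift analyticOrderAt auxXi z to ℕ using ht with m hm
    have : m ≠ 0 := by rintro rfl; simp at h0
    simp
    omega
  have hnn : ∀ z, 0 ≤ D z := fun z => hanU.divisor_nonneg z
  have hsub : u ⊆ hfin.toFinset := by
    intro z hz
    have := hone z hz
    simp only [Set.Finite.mem_toFinset, Function.mem_support]
    omega
  have : (u.card : ℤ) ≤ ∑ᶠ z, D z := by
    rw [finsum_eq_sum _ hfin]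
    calc (u.card : ℤ) = ∑ z ∈ u, 1 := by simp
      _ ≤ ∑ z ∈ u, D z := Finset.sum_le_sum hone
      _ ≤ _ := Finset.sum_le_sum_of_subset_of_nonneg hsub fun z _ _ => hnn z
  exact_mod_cast this

lemma aux_card_le' : ∃ A : ℝ, 0 < A ∧ ∀ (k : ℕ) (u : Finset ℂ),
    (∀ z ∈ u, NontrivialZero z ∧ ‖z‖ ≤ 2 ^ k) → (u.card : ℝ) ≤ A * (k + 1) * 2 ^ k := by
  obtain ⟨K, hK, h⟩ := aux_card_le
  have hl2 := Real.log_pos one_lt_two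
  have hlK := Real.log_nonneg hK
  refine ⟨(Real.log K + 25) / Real.log 2, by positivity, fun k u hu => ?_⟩
  have := h (2 ^ k) u Nat.one_le_two_pow (by simpa using hu)
  refine this.trans ?_
  rw [div_mul_eq_mul_div, div_mul_eq_mul_div]
  gcongr
  set n := 2 ^ k with hn
  have hn1 : 1 ≤ n := Nat.one_le_two_pow
  have hnr : (n : ℝ) = 2 ^ k := by simp [hn]
  have hn1' : (1 : ℝ) ≤ n := by exact_mod_cast hn1
  have hfp : (0 : ℝ) < (2 * n + 3).factorial := by exact_mod_cast (2 * n + 3).factorial_pos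
  rw [Real.log_mul (by positivity) hfp.ne']
  have h1 : Real.log (2 * n + 3).factorial ≤ (2 * n + 3) * Real.log (2 * n + 3) := by
    have : ((2 * n + 3).factorial : ℝ) ≤ ((2 * n + 3 : ℕ) : ℝ) ^ (2 * n + 3) := by
      exact_mod_cast Nat.factorial_le_pow _
    have := Real.log_le_log hfp this
    rw [Real.log_pow] at this
    push_cast at this
    exact this
  have h2 : Real.log (2 * n + 3) ≤ 4 + k := by
    have : (2 * (n : ℝ) + 3) ≤ 5 * 2 ^ k := by rw [← hnr]; linarith
    have := Real.log_le_log (by positivity) this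
    rw [Real.log_mul (by norm_num) (by positivity), Real.log_pow] at this
    have l5 : Real.log 5 ≤ 5 - 1 := Real.log_le_sub_one_of_pos (by norm_num)
    have l2 : Real.log 2 ≤ 2 - 1 := Real.log_le_sub_one_of_pos (by norm_num)
    have : (k : ℝ) * Real.log 2 ≤ k * 1 := by gcongr; linarith
    linarith
  have hk : (0 : ℝ) ≤ k := Nat.cast_nonneg k
  rw [← hnr]
  have h3 : (2 * (n : ℝ) + 3) * Real.log (2 * n + 3) ≤ (5 * n) * (4 * (k + 1)) := by
    gcongr
    · exact Real.log_nonneg (by linarith)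
    · linarith
    · linarith
  have h4 : Real.log K ≤ Real.log K * ((k + 1) * n) := by
    have : (1 : ℝ) ≤ (k + 1) * n := by nlinarith
    nlinarith
  have h5 : 0 ≤ (k : ℝ) * n := by positivity
  nlinarith

lemma aux_sum_le : ∃ S : ℝ, 0 < S ∧ ∀ u : Finset ℂ, (∀ z ∈ u, NontrivialZero z) →
    ∑ z ∈ u, 1 / (1 + ‖z‖) ^ 2 ≤ S := by
  classical
  obtain ⟨A, hA, h⟩ := aux_card_le'
  have hsum : Summable (fun k : ℕ => 4 * A * (((k : ℝ) + 1) * (1 / 2) ^ k)) := by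
    apply Summable.mul_left
    have h1 := summable_pow_mul_geometric_of_norm_lt_one 1 (r := (1 / 2 : ℝ)) (by norm_num)
    have h2 := summable_geometric_of_lt_one (r := (1 / 2 : ℝ)) (by norm_num) (by norm_num)
    refine (h1.add h2).congr fun k => ?_
    ring
  refine ⟨∑' k : ℕ, 4 * A * (((k : ℝ) + 1) * (1 / 2) ^ k),
    hsum.tsum_pos (fun k => by positivity) 0 (by positivity), fun u hu => ?_⟩
  have hex : ∀ z : ℂ, ∃ k : ℕ, ‖z‖ ≤ 2 ^ k ∧ 1 / (1 + ‖z‖) ^ 2 ≤ 4 * (1 / 4) ^ k := by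
    intro z
    have he : ∃ k : ℕ, ‖z‖ ≤ 2 ^ k :=
      (pow_unbounded_of_one_lt ‖z‖ one_lt_two).imp fun _ h => h.le
    refine ⟨Nat.find he, Nat.find_spec he, ?_⟩
    have hz := norm_nonneg z
    rcases hk : Nat.find he with _ | j
    · rw [div_le_iff₀ (by positivity)]
      simp; nlinarith
    · have hj : ¬ ‖z‖ ≤ 2 ^ j := Nat.find_min he (by omega)
      push Not at hj
      have e : 4 * (1 / 4 : ℝ) ^ (j + 1) = 1 / (2 ^ j) ^ 2 := by
        rw [← pow_mul, mul_comm j 2, pow_mul, pow_succ, one_div_pow]; norm_num; ring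
      rw [e]
      gcongr
      linarith
  choose κ hκ1 hκ2 using hex
  set N := u.sup κ + 1 with hN
  calc ∑ z ∈ u, 1 / (1 + ‖z‖) ^ 2
      ≤ ∑ z ∈ u, ∑ k ∈ Finset.range N, if ‖z‖ ≤ 2 ^ k then 4 * (1 / 4 : ℝ) ^ k else 0 := by
        refine Finset.sum_le_sum fun z hz => ?_
        have hm : κ z ∈ Finset.range N := by
          have := Finset.le_sup (f := κ) hz
          simp [hN]; omega
        have := Finset.single_le_sum (s := Finset.range N)
          (f := fun k => if ‖z‖ ≤ 2 ^ k then 4 * (1 / 4 : ℝ) ^ k else 0)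
          (fun k _ => by split_ifs <;> positivity) hm
        simp only [hκ1 z, if_true] at this
        exact (hκ2 z).trans this
    _ = ∑ k ∈ Finset.range N, ∑ z ∈ u, if ‖z‖ ≤ 2 ^ k then 4 * (1 / 4 : ℝ) ^ k else 0 :=
        Finset.sum_comm
    _ ≤ ∑ k ∈ Finset.range N, 4 * A * (((k : ℝ) + 1) * (1 / 2) ^ k) := by
        refine Finset.sum_le_sum fun k _ => ?_
        rw [← Finset.sum_filter, Finset.sum_const, nsmul_eq_mul]
        have hc := h k (u.filter fun z => ‖z‖ ≤ 2 ^ k) (fun z hz => by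
          rw [Finset.mem_filter] at hz
          exact ⟨hu z hz.1, hz.2⟩)
        calc _ ≤ A * (k + 1) * 2 ^ k * (4 * (1 / 4 : ℝ) ^ k) := by gcongr
          _ = _ := by
            have : (1 / 2 : ℝ) ^ k = 2 ^ k * (1 / 4) ^ k := by rw [← mul_pow]; norm_num
            rw [this]; ring
    _ ≤ _ := hsum.sum_le_tsum _ fun k _ => by positivity

lemma aux_norm_lower : ∃ ε : ℝ, 0 < ε ∧ ∀ z : ℂ, NontrivialZero z → ε ≤ ‖z‖ := by
  have hc : ContinuousAt auxXi 0 := (auxXi_differentiable 0).continuousAt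
  have : ∀ᶠ z in nhds (0 : ℂ), auxXi z ≠ 0 := hc.eventually_ne (by simp [auxXi_zero])
  obtain ⟨ε, hε, h⟩ := Metric.eventually_nhds_iff.1 this
  refine ⟨ε, hε, fun z hz => ?_⟩
  by_contra hlt
  exact h (by simpa using hlt) (auxXi_eq_zero hz)

lemma aux_sum_le' : ∃ S : ℝ, 0 < S ∧ ∀ u : Finset ℂ, (∀ z ∈ u, NontrivialZero z) →
    ∑ z ∈ u, 1 / (‖z‖ * ‖z + 1‖) ≤ S := by
  obtain ⟨S, hS, h⟩ := aux_sum_le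
  obtain ⟨ε, hε, hl⟩ := aux_norm_lower
  refine ⟨(1 / ε + 1) ^ 2 * S, by positivity, fun u hu => ?_⟩
  refine le_trans ?_ (mul_le_mul_of_nonneg_left (h u hu) (by positivity))
  rw [Finset.mul_sum]
  refine Finset.sum_le_sum fun z hz => ?_
  have h1 := hl z (hu z hz)
  have hz0 : 0 < ‖z‖ := hε.trans_le h1
  have h2 : ‖z‖ ≤ ‖z + 1‖ := by
    have := (hu z hz).2.1
    rw [Complex.norm_def, Complex.norm_def]
    apply Real.sqrt_le_sqrt
    simp [Complex.normSq_apply]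
    nlinarith
  have h3 : 1 + ‖z‖ ≤ (1 / ε + 1) * ‖z‖ := by
    have : 1 ≤ 1 / ε * ‖z‖ := by
      rw [div_mul_eq_mul_div, one_mul, one_le_div hε]; exact h1
    linarith
  have h4 : (1 + ‖z‖) ^ 2 ≤ (1 / ε + 1) ^ 2 * (‖z‖ * ‖z + 1‖) := by
    calc _ ≤ ((1 / ε + 1) * ‖z‖) ^ 2 := by gcongr
      _ = (1 / ε + 1) ^ 2 * (‖z‖ * ‖z‖) := by ring
      _ ≤ _ := by gcongr
  rw [mul_one_div, div_le_div_iff₀ (mul_pos hz0 (hz0.trans_le h2)) (by positivity), one_mul]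
  exact h4

theorem stmt_14 :
    ∃ C > 0, ∀ x T η : ℝ, 2 ≤ x → 2 ≤ T →
      (∀ ρ : ℂ, NontrivialZero ρ → |ρ.im| ≤ T → ρ.re ≤ η) →
      ‖∑' ρ : {ρ : ℂ // NontrivialZero ρ ∧ |ρ.im| ≤ T},
          (x : ℂ) ^ (ρ : ℂ) / ((ρ : ℂ) * ((ρ : ℂ) + 1))‖ ≤ C * x ^ η := by
  obtain ⟨S, hS, h⟩ := aux_sum_le'
  refine ⟨S, hS, fun x T η hx hT hη => ?_⟩
  have hx0 : 0 < x := by linarith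
  have hfin : ∀ u : Finset {ρ : ℂ // NontrivialZero ρ ∧ |ρ.im| ≤ T},
      ∑ ρ ∈ u, ‖(x : ℂ) ^ (ρ : ℂ) / ((ρ : ℂ) * ((ρ : ℂ) + 1))‖ ≤ S * x ^ η := by
    intro u
    have hu := h (u.map (Function.Embedding.subtype _)) (by
      intro z hz
      obtain ⟨w, _, rfl⟩ := Finset.mem_map.1 hz
      exact w.2.1)
    rw [Finset.sum_map] at hu
    refine le_trans ?_ (mul_le_mul_of_nonneg_right hu (Real.rpow_nonneg hx0.le η))
    rw [Finset.sum_mul]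
    refine Finset.sum_le_sum fun ρ _ => ?_
    rw [norm_div, norm_mul, Complex.norm_cpow_eq_rpow_re_of_pos hx0, one_div_mul_eq_div]
    simp only [Function.Embedding.coe_subtype]
    gcongr
    · linarith
    · exact hη ρ ρ.2.1 ρ.2.2
  have hsum := summable_of_sum_le (fun ρ => norm_nonneg _) hfin
  exact (norm_tsum_le_tsum_norm hsum).trans (Real.tsum_le_of_sum_le (fun ρ => norm_nonneg _) hfin)
end
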